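/- For a positive recurrent reversible chain and distinct states η, ξ, and any μ-integrable g: E_η[ ∫_0^{T_ξ} g(η_s) ds ] = ⟨g, f_{ηξ}⟩_μ / Cap({η},{ξ}), where f_{ηξ}(ζ) = P_ζ[T_η < T_ξ]. -/

import Mathlib

open MeasureTheory
open scoped ENNReal
open scoped Classical

/-- Hitting time (first `n ≥ 0` with `ω n ∈ A`) of a discrete-time path. -/
noncomputable def hitT {E : Type*} (A : Set E) (ω : ℕ → E) : ℕ∞ :=
  ⨅ (n : ℕ) (_ : ω n ∈ A), (n : ℕ∞)

/-- Return time (first `n > 0` with `ω n ∈ A`) of a discrete-time path. -/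
noncomputable def retT {E : Type*} (A : Set E) (ω : ℕ → E) : ℕ∞ :=
  ⨅ (n : ℕ) (_ : 0 < n ∧ ω n ∈ A), (n : ℕ∞)

section FirstStep

variable {E : Type*}

/-- The path seen from time one on. -/
def shiftPath (ω : ℕ → E) : ℕ → E := fun n => ω (n + 1)

lemma hitT_eq_zero {A : Set E} {ω : ℕ → E} (h : ω 0 ∈ A) : hitT A ω = 0 :=
  le_antisymm (iInf₂_le_of_le 0 h (by simp)) zero_le

lemma retT_eq_hitT_shiftPath (A : Set E) (ω : ℕ → E) :
    retT A ω = hitT A (shiftPath ω) + 1 := by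
  refine le_antisymm ?_ ?_
  · simp only [hitT, ENat.iInf_add]
    exact le_iInf₂ fun n hn => iInf₂_le_of_le (n + 1) ⟨n.succ_pos, hn⟩ (by simp)
  · refine le_iInf₂ fun n hn => ?_
    obtain ⟨k, rfl⟩ := Nat.exists_eq_succ_of_ne_zero hn.1.ne'
    have : hitT A (shiftPath ω) ≤ k := iInf₂_le k hn.2
    push_cast
    gcongr

lemma hitT_eq_hitT_shiftPath {A : Set E} {ω : ℕ → E} (h : ω 0 ∉ A) :
    hitT A ω = hitT A (shiftPath ω) + 1 := by
  rw [← retT_eq_hitT_shiftPath]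
  refine le_antisymm (le_iInf₂ fun n hn => iInf₂_le n hn.2) (le_iInf₂ fun n hn => ?_)
  exact iInf₂_le n ⟨Nat.pos_of_ne_zero fun h0 => h (h0 ▸ hn), hn⟩

lemma exists_hitT_eq_coe {A : Set E} {ω : ℕ → E} (h : hitT A ω ≠ ⊤) :
    ∃ n : ℕ, hitT A ω = n ∧ ω n ∈ A := by
  by_contra! hc
  have key : ∀ n : ℕ, (n : ℕ∞) ≤ hitT A ω := by
    intro n
    induction n with
    | zero => simp
    | succ k ih =>
      have hk : ω k ∉ A := fun hk => hc k (le_antisymm (iInf₂_le k hk) ih) hk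
      push_cast
      rw [ENat.add_one_le_iff (ENat.natCast_ne_top k)]
      exact lt_of_le_of_ne ih fun e => by
        obtain ⟨m, hm⟩ : ∃ m : ℕ, ω m ∈ A ∧ (m : ℕ∞) < (k : ℕ∞) + 1 := by
          by_contra! hm
          have : ((k : ℕ∞) + 1) ≤ hitT A ω := le_iInf₂ hm
          rw [← e] at this
          exact absurd this (by exact_mod_cast Nat.not_succ_le_self k)
        have h1 : (m : ℕ∞) ≤ k := ENat.lt_natCast_add_one_iff.1 hm.2
        have h2 : hitT A ω ≤ m := iInf₂_le m hm.1
        exact hc m (le_antisymm h2 (h1.trans e.le)) hm.1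
  exact h (ENat.eq_top_iff_forall_ge.2 key)

lemma hitT_singleton_ne {a b : E} (hab : a ≠ b) {ω : ℕ → E} (h : hitT {a} ω ≠ ⊤) :
    hitT {a} ω ≠ hitT {b} ω := by
  intro e
  obtain ⟨n, hn, hna⟩ := exists_hitT_eq_coe h
  obtain ⟨m, hm, hmb⟩ := exists_hitT_eq_coe (e ▸ h)
  have : n = m := by exact_mod_cast hn.symm.trans (e.trans hm)
  subst this
  exact hab (hna.symm.trans hmb)

variable [MeasurableSpace E]

/-- A family of path laws `ℙ` of the Markov chain with transition probabilities `p`. -/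
structure IsMarkovFamily (p : E → E → ℝ≥0∞) (ℙ : E → Measure (ℕ → E)) : Prop where
  prob : ∀ a, IsProbabilityMeasure (ℙ a)
  start : ∀ a, ∀ᵐ ω ∂ℙ a, ω 0 = a
  step : ∀ a C, MeasurableSet C → ℙ a (shiftPath ⁻¹' C) = ∑' c, p a c * ℙ c C

/-- The probability that the chain started at `a` is at `b` at time `n`, before hitting `ξ`. -/
noncomputable def killedKernel (ℙ : E → Measure (ℕ → E)) (ξ : E) (n : ℕ) (a b : E) : ℝ≥0∞ :=
  ℙ a {ω | ω n = b ∧ (n : ℕ∞) < hitT {ξ} ω}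

/-- The probability of hitting `α` strictly before `β`, starting from `a`. -/
noncomputable def hitBefore (ℙ : E → Measure (ℕ → E)) (α β a : E) : ℝ≥0∞ :=
  ℙ a {ω | hitT {α} ω < hitT {β} ω}

/-- The Green function of the chain killed on hitting `ξ`. -/
noncomputable def killedGreen (ℙ : E → Measure (ℕ → E)) (ξ a b : E) : ℝ≥0∞ :=
  ∑' n, killedKernel ℙ ξ n a b

namespace IsMarkovFamily

variable {p : E → E → ℝ≥0∞} {ℙ : E → Measure (ℕ → E)}

lemma measure_congr (h : IsMarkovFamily p ℙ) {a : E} {S T : Set (ℕ → E)}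
    (hST : ∀ ω, ω 0 = a → (ω ∈ S ↔ ω ∈ T)) : ℙ a S = ℙ a T := by
  refine MeasureTheory.measure_congr ?_
  filter_upwards [h.start a] with ω hω
  exact propext (hST ω hω)

lemma measure_eq_zero (h : IsMarkovFamily p ℙ) {a : E} {S : Set (ℕ → E)}
    (hS : ∀ ω, ω 0 = a → ω ∉ S) : ℙ a S = 0 := by
  rw [h.measure_congr (T := ∅) fun ω hω => by simp [hS ω hω], measure_empty]

lemma measure_eq_one (h : IsMarkovFamily p ℙ) {a : E} {S : Set (ℕ → E)}
    (hS : ∀ ω, ω 0 = a → ω ∈ S) : ℙ a S = 1 := by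
  have := h.prob a
  rw [h.measure_congr (T := Set.univ) fun ω hω => by simp [hS ω hω], measure_univ]

lemma measure_eq_tsum (h : IsMarkovFamily p ℙ) {a : E} {S C : Set (ℕ → E)} (hC : MeasurableSet C)
    (hS : ∀ ω, ω 0 = a → (ω ∈ S ↔ shiftPath ω ∈ C)) : ℙ a S = ∑' c, p a c * ℙ c C := by
  rw [h.measure_congr (T := shiftPath ⁻¹' C) hS, h.step a C hC]

lemma killedKernel_zero (h : IsMarkovFamily p ℙ) (ξ a b : E) :
    killedKernel ℙ ξ 0 a b = if a = b ∧ a ≠ ξ then 1 else 0 := by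
  split_ifs with hab
  · refine h.measure_eq_one fun ω hω => ⟨hω.trans hab.1, ?_⟩
    rw [hitT_eq_hitT_shiftPath (by simpa [hω] using hab.2)]
    simp
  · refine h.measure_eq_zero fun ω hω hmem => hab ⟨hω.symm.trans hmem.1, fun e => ?_⟩
    have := hmem.2
    rw [hitT_eq_zero (by simp [hω, e])] at this
    simp at this

lemma hitBefore_self (h : IsMarkovFamily p ℙ) {α β : E} (hαβ : α ≠ β) :
    hitBefore ℙ α β α = 1 := by
  refine h.measure_eq_one fun ω hω => ?_
  rw [Set.mem_ofPred_eq, hitT_eq_zero (by simp [hω]),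
    hitT_eq_hitT_shiftPath (by simpa [hω] using hαβ)]
  exact add_pos_of_right one_pos _

lemma hitBefore_right (h : IsMarkovFamily p ℙ) (α β : E) : hitBefore ℙ α β β = 0 := by
  refine h.measure_eq_zero fun ω hω => ?_
  rw [Set.mem_ofPred_eq, hitT_eq_zero (A := {β}) (by simp [hω])]
  simp

end IsMarkovFamily

variable [MeasurableSingletonClass E]

lemma measurableSet_eval_eq (n : ℕ) (b : E) : MeasurableSet {ω : ℕ → E | ω n = b} :=
  measurable_pi_apply (X := fun _ => E) n (measurableSet_singleton b)

lemma sum_map_restrict_apply_singleton (ℙ : E → Measure (ℕ → E)) (ξ a b : E) :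
    Measure.sum (fun n : ℕ => ((ℙ a).restrict {ω | (n : ℕ∞) < hitT {ξ} ω}).map
      fun ω => ω n) {b} = killedGreen ℙ ξ a b := by
  rw [Measure.sum_apply _ (measurableSet_singleton b)]
  refine tsum_congr fun n => ?_
  rw [Measure.map_apply (measurable_pi_apply n) (measurableSet_singleton b),
    Measure.restrict_apply (measurable_pi_apply n (measurableSet_singleton b))]
  rfl

variable [Countable E]

lemma measurable_hitT (A : Set E) : Measurable (hitT A) := by
  have : BorelSpace ℕ∞ := ⟨borel_eq_top_of_countable.symm⟩
  refine measurable_of_Iio fun x => ?_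
  have : hitT A ⁻¹' Set.Iio x = ⋃ n : ℕ, {ω | ω n ∈ A ∧ (n : ℕ∞) < x} := by
    ext ω
    simp [hitT, iInf_lt_iff]
  rw [this]
  exact .iUnion fun n => .inter (measurable_pi_apply n A.to_countable.measurableSet) (.const _)

lemma measurableSet_hitT_lt (α β : E) : MeasurableSet {ω | hitT {α} ω < hitT {β} ω} :=
  ((measurable_hitT {α}).prodMk (measurable_hitT {β}))
    (.of_discrete (s := {x : ℕ∞ × ℕ∞ | x.1 < x.2}))

lemma measurableSet_natCast_lt_hitT (ξ : E) (n : ℕ) :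
    MeasurableSet {ω | (n : ℕ∞) < hitT {ξ} ω} :=
  measurable_hitT {ξ} (.of_discrete (s := Set.Ioi (n : ℕ∞)))

namespace IsMarkovFamily

variable {p : E → E → ℝ≥0∞} {ℙ : E → Measure (ℕ → E)}

lemma killedKernel_succ (h : IsMarkovFamily p ℙ) (ξ : E) (n : ℕ) (a b : E) :
    killedKernel ℙ ξ (n + 1) a b =
      if a = ξ then 0 else ∑' c, p a c * killedKernel ℙ ξ n c b := by
  split_ifs with ha
  · refine h.measure_eq_zero fun ω hω hmem => ?_
    have := hmem.2
    rw [hitT_eq_zero (by simp [hω, ha])] at this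
    simp at this
  · refine h.measure_eq_tsum
      ((measurableSet_eval_eq n b).inter (measurableSet_natCast_lt_hitT ξ n)) fun ω hω => ?_
    rw [Set.mem_ofPred_eq, hitT_eq_hitT_shiftPath (by simpa [hω] using ha)]
    push_cast
    rw [ENat.add_lt_add_iff_right ENat.one_ne_top]
    rfl

lemma killedKernel_succ' (h : IsMarkovFamily p ℙ) (ξ : E) (n : ℕ) (a b : E) :
    killedKernel ℙ ξ (n + 1) a b =
      if b = ξ then 0 else ∑' c, killedKernel ℙ ξ n a c * p c b := by
  induction n generalizing a with
  | zero =>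
    rw [h.killedKernel_succ]
    simp only [h.killedKernel_zero]
    by_cases ha : a = ξ
    · simp [ha]
    · rw [if_neg ha, tsum_eq_single b fun c hc => by simp [hc],
        tsum_eq_single a fun c hc => by simp [hc.symm]]
      by_cases hb : b = ξ <;> simp [ha, hb]
  | succ n ih =>
    rw [h.killedKernel_succ]
    simp only [ih, h.killedKernel_succ ξ n a]
    by_cases ha : a = ξ
    · simp [ha]
    · by_cases hb : b = ξ
      · simp [hb]
      · simp only [ha, hb, if_false, ← ENNReal.tsum_mul_left, ← ENNReal.tsum_mul_right]
        rw [ENNReal.tsum_comm]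
        simp only [mul_assoc]

lemma killedKernel_symm (h : IsMarkovFamily p ℙ) {m : E → ℝ≥0∞}
    (hm : ∀ a b, m a * p a b = m b * p b a) (ξ : E) (n : ℕ) (a b : E) :
    m a * killedKernel ℙ ξ n a b = m b * killedKernel ℙ ξ n b a := by
  induction n generalizing a with
  | zero =>
    simp only [h.killedKernel_zero]
    by_cases hab : a = b
    · simp [hab]
    · simp [hab, Ne.symm hab]
  | succ n ih =>
    rw [h.killedKernel_succ, h.killedKernel_succ']
    split_ifs with ha
    · simp
    · simp only [← ENNReal.tsum_mul_left]
      refine tsum_congr fun c => ?_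
      rw [← mul_assoc, hm, mul_assoc, mul_left_comm, ih, mul_left_comm, mul_comm (p c a)]

lemma killedGreen_symm (h : IsMarkovFamily p ℙ) {m : E → ℝ≥0∞}
    (hm : ∀ a b, m a * p a b = m b * p b a) (ξ a b : E) :
    m a * killedGreen ℙ ξ a b = m b * killedGreen ℙ ξ b a := by
  simp only [killedGreen, ← ENNReal.tsum_mul_left, h.killedKernel_symm hm ξ _ a b]

lemma hitBefore_eq_tsum (h : IsMarkovFamily p ℙ) {α β a : E} (hα : a ≠ α) (hβ : a ≠ β) :
    hitBefore ℙ α β a = ∑' c, p a c * hitBefore ℙ α β c := by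
  refine h.measure_eq_tsum (measurableSet_hitT_lt α β) fun ω hω => ?_
  rw [Set.mem_ofPred_eq, hitT_eq_hitT_shiftPath (A := {α}) (by simpa [hω] using hα),
    hitT_eq_hitT_shiftPath (A := {β}) (by simpa [hω] using hβ), ENat.add_lt_add_iff_right ENat.one_ne_top]
  rfl

lemma measure_retT_lt (h : IsMarkovFamily p ℙ) (α β a : E) :
    ℙ a {ω | retT {α} ω < retT {β} ω} = ∑' c, p a c * hitBefore ℙ α β c := by
  refine h.measure_eq_tsum (measurableSet_hitT_lt α β) fun ω hω => ?_
  rw [Set.mem_ofPred_eq, retT_eq_hitT_shiftPath, retT_eq_hitT_shiftPath,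
    ENat.add_lt_add_iff_right ENat.one_ne_top]
  rfl

lemma killedGreen_eq (h : IsMarkovFamily p ℙ) {ξ a : E} (ha : a ≠ ξ) (b : E) :
    killedGreen ℙ ξ a b = (if a = b then 1 else 0) + ∑' c, p a c * killedGreen ℙ ξ c b := by
  rw [killedGreen, tsum_eq_zero_add' ENNReal.summable, h.killedKernel_zero]
  simp only [h.killedKernel_succ, ha, if_false, killedGreen, ← ENNReal.tsum_mul_left]
  rw [ENNReal.tsum_comm]
  simp [ha]

lemma killedGreen_left (h : IsMarkovFamily p ℙ) (ξ b : E) : killedGreen ℙ ξ ξ b = 0 := by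
  refine ENNReal.tsum_eq_zero.2 fun n => ?_
  cases n with
  | zero => simp [h.killedKernel_zero]
  | succ n => simp [h.killedKernel_succ]

/-- The expected number of visits to `b` during the first `N` steps, before hitting `ξ`, is
dominated by the corresponding number when starting from `b`. -/
lemma sum_killedKernel_le (h : IsMarkovFamily p ℙ) {ξ b : E} (hb : b ≠ ξ) (N : ℕ) (a : E) :
    ∑ n ∈ Finset.range N, killedKernel ℙ ξ n a b ≤
      hitBefore ℙ b ξ a * ∑ n ∈ Finset.range N, killedKernel ℙ ξ n b b := by
  induction N generalizing a with
  | zero => simp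
  | succ N ih =>
    by_cases hab : a = b
    · simp [hab, h.hitBefore_self hb]
    · rw [Finset.sum_range_succ', h.killedKernel_zero]
      by_cases haξ : a = ξ
      · simp [h.killedKernel_succ, haξ]
      · simp only [h.killedKernel_succ, haξ, hab, if_false, false_and, add_zero]
        rw [← Summable.tsum_finsetSum fun _ _ => ENNReal.summable]
        simp only [← Finset.mul_sum]
        calc ∑' c, p a c * ∑ n ∈ Finset.range N, killedKernel ℙ ξ n c b
            ≤ ∑' c, p a c * (hitBefore ℙ b ξ c *
                ∑ n ∈ Finset.range N, killedKernel ℙ ξ n b b) :=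
              ENNReal.tsum_le_tsum fun c => by gcongr; exact ih c
          _ = hitBefore ℙ b ξ a * ∑ n ∈ Finset.range N, killedKernel ℙ ξ n b b := by
              rw [h.hitBefore_eq_tsum hab haξ, ← ENNReal.tsum_mul_right]
              simp only [mul_assoc]
          _ ≤ _ := by gcongr; exact N.le_succ

lemma measure_hitT_lt_and_le_mul_killedGreen_le (h : IsMarkovFamily p ℙ) {ξ b : E} (N : ℕ)
    (a : E) :
    ℙ a {ω | hitT {b} ω < hitT {ξ} ω ∧ hitT {b} ω ≤ N} * killedGreen ℙ ξ b b ≤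
      killedGreen ℙ ξ a b := by
  have := h.prob
  induction N generalizing a with
  | zero =>
    by_cases hab : a = b
    · subst hab
      exact mul_le_of_le_one_left' prob_le_one
    · rw [h.measure_eq_zero, zero_mul]
      · exact zero_le
      · intro ω hω hmem
        have := hmem.2
        rw [hitT_eq_hitT_shiftPath (by simpa [hω] using hab)] at this
        simp at this
  | succ N ih =>
    by_cases hab : a = b
    · subst hab
      exact mul_le_of_le_one_left' prob_le_one
    by_cases haξ : a = ξ
    · rw [h.measure_eq_zero, zero_mul]
      · exact zero_le
      · intro ω hω hmem
        have := hmem.1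
        rw [hitT_eq_zero (A := {ξ}) (by simp [hω, haξ])] at this
        simp at this
    · rw [h.killedGreen_eq haξ, if_neg hab, zero_add,
        h.measure_eq_tsum (C := {ω | hitT {b} ω < hitT {ξ} ω ∧ hitT {b} ω ≤ N}),
        ← ENNReal.tsum_mul_right]
      · refine ENNReal.tsum_le_tsum fun c => ?_
        rw [mul_assoc]
        gcongr
        exact ih c
      · exact (measurableSet_hitT_lt b ξ).inter
          (measurable_hitT {b} (.of_discrete (s := Set.Iic (N : ℕ∞))))
      · intro ω hω
        rw [Set.mem_ofPred_eq, hitT_eq_hitT_shiftPath (A := {b}) (by simpa [hω] using hab),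
          hitT_eq_hitT_shiftPath (A := {ξ}) (by simpa [hω] using haξ),
          ENat.add_lt_add_iff_right ENat.one_ne_top]
        push_cast
        rw [ENat.add_le_add_iff_right ENat.one_ne_top]
        rfl

/-- Strong Markov property at the hitting time of `b`, for the killed Green function. -/
lemma killedGreen_eq_mul (h : IsMarkovFamily p ℙ) {ξ b : E} (hb : b ≠ ξ) (a : E) :
    killedGreen ℙ ξ a b = hitBefore ℙ b ξ a * killedGreen ℙ ξ b b := by
  refine le_antisymm ?_ ?_
  · rw [killedGreen, ENNReal.tsum_eq_iSup_nat]
    refine iSup_le fun N => (h.sum_killedKernel_le hb N a).trans ?_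
    gcongr
    exact ENNReal.sum_le_tsum _
  · have hU : {ω : ℕ → E | hitT {b} ω < hitT {ξ} ω} =
        ⋃ N : ℕ, {ω | hitT {b} ω < hitT {ξ} ω ∧ hitT {b} ω ≤ N} := by
      ext ω
      simp only [Set.mem_ofPred_eq, Set.mem_iUnion, exists_and_left]
      refine ⟨fun hlt => ⟨hlt, ?_⟩, And.left⟩
      obtain ⟨n, hn, -⟩ := exists_hitT_eq_coe (ne_top_of_lt hlt)
      exact ⟨n, hn.le⟩
    have hmono : Monotone fun N : ℕ =>
        {ω : ℕ → E | hitT {b} ω < hitT {ξ} ω ∧ hitT {b} ω ≤ N} :=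
      fun N M hNM ω hω => ⟨hω.1, hω.2.trans (by exact_mod_cast hNM)⟩
    rw [hitBefore, hU, hmono.measure_iUnion, ENNReal.iSup_mul]
    exact iSup_le fun N => h.measure_hitT_lt_and_le_mul_killedGreen_le N a

/-- A chain that a.s. visits `ξ` reaches it before returning to its starting point `η` with
positive probability. -/
lemma measure_retT_lt_ne_zero (h : IsMarkovFamily p ℙ) {η ξ : E} (hηξ : η ≠ ξ)
    (hrec : ℙ η {ω | ∃ n, 0 < n ∧ ω n = ξ} = 1) :
    ℙ η {ω | retT {ξ} ω < retT {η} ω} ≠ 0 := by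
  have := h.prob
  intro hP
  rw [h.measure_retT_lt] at hP
  have key : ∀ (n : ℕ) (a : E), ℙ a {ω | ω n = ξ} ≤ hitBefore ℙ ξ η a := by
    intro n
    induction n with
    | zero =>
      intro a
      by_cases ha : a = ξ
      · rw [ha, h.hitBefore_self hηξ.symm]
        exact prob_le_one
      · exact (h.measure_eq_zero fun ω hω hmem => ha (hω.symm.trans hmem)).trans_le zero_le
    | succ n ih =>
      intro a
      by_cases ha : a = ξ
      · rw [ha, h.hitBefore_self hηξ.symm]
        exact prob_le_one
      · rw [h.measure_eq_tsum (S := {ω | ω (n + 1) = ξ}) (measurableSet_eval_eq n ξ)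
          fun ω hω => Iff.rfl]
        have hle : ∑' c, p a c * ℙ c {ω | ω n = ξ} ≤ ∑' c, p a c * hitBefore ℙ ξ η c :=
          ENNReal.tsum_le_tsum fun c => by gcongr; exact ih c
        by_cases haη : a = η
        · subst haη
          exact (hle.trans hP.le).trans zero_le
        · rwa [h.hitBefore_eq_tsum ha haη]
  have hzero : ℙ η {ω | ∃ n, 0 < n ∧ ω n = ξ} = 0 := by
    refine measure_mono_null (t := ⋃ n : ℕ, {ω | ω n = ξ}) ?_ (measure_iUnion_null fun n => ?_)
    · rintro ω ⟨n, -, hn⟩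
      exact Set.mem_iUnion.2 ⟨n, hn⟩
    · exact le_antisymm ((key n η).trans (h.hitBefore_right ξ η).le) zero_le
  simp [hzero] at hrec

lemma measure_retT_lt_add_measure_retT_lt (h : IsMarkovFamily p ℙ) {η ξ : E} (hηξ : η ≠ ξ)
    (hrec : ℙ η {ω | ∃ n, 0 < n ∧ ω n = ξ} = 1) :
    ℙ η {ω | retT {η} ω < retT {ξ} ω} + ℙ η {ω | retT {ξ} ω < retT {η} ω} = 1 := by
  have := h.prob
  have hmeas : MeasurableSet {ω : ℕ → E | retT {ξ} ω < retT {η} ω} := by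
    have hshift : Measurable (shiftPath : (ℕ → E) → ℕ → E) :=
      measurable_pi_lambda _ fun n => measurable_pi_apply (n + 1)
    simp only [retT_eq_hitT_shiftPath, ENat.add_lt_add_iff_right ENat.one_ne_top]
    exact hshift (measurableSet_hitT_lt ξ η)
  rw [← measure_union _ hmeas]
  · refine le_antisymm prob_le_one (hrec.symm.le.trans (measure_mono ?_))
    rintro ω ⟨n, hn, hnξ⟩
    have hfin : retT {ξ} ω ≠ ⊤ :=
      ne_top_of_le_ne_top (ENat.natCast_ne_top n) (iInf₂_le n ⟨hn, hnξ⟩)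
    simp only [retT_eq_hitT_shiftPath, Set.mem_union, Set.mem_ofPred_eq,
      ENat.add_lt_add_iff_right ENat.one_ne_top] at hfin ⊢
    exact lt_or_gt_of_ne (hitT_singleton_ne hηξ.symm fun e => hfin (by simp [e])).symm
  · exact Set.disjoint_left.2 fun ω h1 h2 => lt_asymm (α := ℕ∞) h1 h2

lemma killedGreen_self_mul (h : IsMarkovFamily p ℙ) {η ξ : E} (hηξ : η ≠ ξ)
    (hrec : ℙ η {ω | ∃ n, 0 < n ∧ ω n = ξ} = 1) :
    killedGreen ℙ ξ η η * ℙ η {ω | retT {ξ} ω < retT {η} ω} = 1 := by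
  have := h.prob
  have hadd := h.measure_retT_lt_add_measure_retT_lt hηξ hrec
  have hP := h.measure_retT_lt_ne_zero hηξ hrec
  set P := ℙ η {ω | retT {ξ} ω < retT {η} ω}
  set r := ℙ η {ω | retT {η} ω < retT {ξ} ω} with hr
  have hr_top : r ≠ ∞ := measure_ne_top _ _
  have hpartial : ∀ N : ℕ, (∑ n ∈ Finset.range N, killedKernel ℙ ξ n η η) * P ≤ 1 := by
    intro N
    set S := ∑ n ∈ Finset.range N, killedKernel ℙ ξ n η η with hS
    have hS_top : S ≠ ∞ := ENNReal.sum_ne_top.2 fun n _ => measure_ne_top _ _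
    have hle : S ≤ r * S + 1 := by
      calc S ≤ ∑ n ∈ Finset.range (N + 1), killedKernel ℙ ξ n η η := by
            rw [hS]
            gcongr
            exact N.le_succ
        _ = ∑' c, p η c * ∑ n ∈ Finset.range N, killedKernel ℙ ξ n c η + 1 := by
            rw [Finset.sum_range_succ', h.killedKernel_zero]
            simp only [h.killedKernel_succ, hηξ, if_false, ne_eq, not_false_eq_true, and_true,
              if_true, Finset.mul_sum]
            rw [Summable.tsum_finsetSum fun _ _ => ENNReal.summable]
        _ ≤ r * S + 1 := by
            rw [hr, h.measure_retT_lt, ← ENNReal.tsum_mul_right]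
            refine add_le_add_left (ENNReal.tsum_le_tsum fun c => ?_) 1
            rw [mul_assoc]
            gcongr
            exact h.sum_killedKernel_le hηξ N c
    have : r * S + S * P ≤ r * S + 1 := by
      rwa [mul_comm r, ← mul_add, hadd, mul_one, mul_comm S]
    exact (ENNReal.add_le_add_iff_left (ENNReal.mul_ne_top hr_top hS_top)).1 this
  have hG_le : killedGreen ℙ ξ η η * P ≤ 1 := by
    rw [killedGreen, ENNReal.tsum_eq_iSup_nat, ENNReal.iSup_mul]
    exact iSup_le hpartial
  have hG_top : killedGreen ℙ ξ η η ≠ ∞ := by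
    intro e
    rw [e, ENNReal.top_mul hP] at hG_le
    simp at hG_le
  have heq : killedGreen ℙ ξ η η = 1 + r * killedGreen ℙ ξ η η := by
    conv_lhs => rw [h.killedGreen_eq hηξ, if_pos rfl]
    rw [hr, h.measure_retT_lt, ← ENNReal.tsum_mul_right]
    congr 1
    refine tsum_congr fun c => ?_
    rw [h.killedGreen_eq_mul hηξ c, mul_assoc]
  have hrG : r * killedGreen ℙ ξ η η ≠ ∞ := ENNReal.mul_ne_top hr_top hG_top
  refine (ENNReal.add_right_inj hrG).1 ?_
  rw [add_comm _ 1, ← heq, mul_comm r, ← mul_add, hadd, mul_one]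

end IsMarkovFamily

/-- The expected additive functional up to the hitting time, in terms of the Green function. -/
lemma integral_tsum_killed (ℙ : E → Measure (ℕ → E)) (ξ a : E) (φ : E → ℝ)
    (hφ : ∑' b, ‖φ b‖ₑ * killedGreen ℙ ξ a b ≠ ∞) :
    ∫ ω, ∑' n : ℕ, (if (n : ℕ∞) < hitT {ξ} ω then φ (ω n) else 0) ∂ℙ a =
      ∑' b, (killedGreen ℙ ξ a b).toReal * φ b := by
  have hφm : Measurable φ := measurable_of_countable φ
  set κ : ℕ → Measure E := fun n =>
    ((ℙ a).restrict {ω | (n : ℕ∞) < hitT {ξ} ω}).map fun ω => ω n with hκ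
  have hint : Integrable φ (Measure.sum κ) := by
    refine ⟨hφm.aestronglyMeasurable, ?_⟩
    rw [HasFiniteIntegral, lintegral_countable']
    simpa only [hκ, sum_map_restrict_apply_singleton] using hφ.lt_top
  have hfm : ∀ n : ℕ, Measurable fun ω : ℕ → E => φ (ω n) :=
    fun n => hφm.comp (measurable_pi_apply n)
  have hind : ∀ n : ℕ, (fun ω : ℕ → E => if (n : ℕ∞) < hitT {ξ} ω then φ (ω n) else 0) =
      Set.indicator {ω | (n : ℕ∞) < hitT {ξ} ω} fun ω => φ (ω n) := fun n => by
    ext ω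
    simp [Set.indicator]
  rw [integral_tsum]
  · have hterm : ∀ n : ℕ, ∫ ω, (if (n : ℕ∞) < hitT {ξ} ω then φ (ω n) else 0) ∂ℙ a =
        ∫ x, φ x ∂κ n := by
      intro n
      rw [hind, integral_indicator (measurableSet_natCast_lt_hitT ξ n),
        integral_map (measurable_pi_apply n).aemeasurable hφm.aestronglyMeasurable]
    simp only [hterm]
    rw [(hasSum_integral_measure hint).tsum_eq, integral_countable hint]
    simp only [Measure.real, hκ, sum_map_restrict_apply_singleton, smul_eq_mul]
  · intro n
    rw [hind]
    exact ((hfm n).indicator (measurableSet_natCast_lt_hitT ξ n)).aestronglyMeasurable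
  · have hterm : ∀ n : ℕ, ∫⁻ ω, ‖if (n : ℕ∞) < hitT {ξ} ω then φ (ω n) else 0‖ₑ ∂ℙ a =
        ∫⁻ x, ‖φ x‖ₑ ∂κ n := by
      intro n
      rw [lintegral_map hφm.enorm (measurable_pi_apply n),
        ← lintegral_indicator (measurableSet_natCast_lt_hitT ξ n)]
      refine lintegral_congr fun ω => ?_
      by_cases hω : (n : ℕ∞) < hitT {ξ} ω <;> simp [Set.indicator, hω]
    simp only [hterm]
    rw [← lintegral_sum_measure]
    exact hint.2.ne

end FirstStep

/-- For a positive recurrent reversible chain and distinct states `η`, `ξ`, and any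
`μ`-integrable `g`, one has
`E_η[∫_0^{T_ξ} g(η_s) ds] = ⟨g, f_{ηξ}⟩_μ / Cap({η},{ξ})`, where
`f_{ηξ}(ζ) = P_ζ[T_η < T_ξ]` and `Cap({η},{ξ}) = lam(η)μ(η) P_η[T_ξ⁺ < T_η⁺]`.
The time integral up to `T_ξ` of the continuous-time chain is expressed through its jump
chain `ℙ` as `G(ω) = ∑_{n < t_ξ(ω)} g(ω_n)/lam(ω_n)`. -/
theorem stmt12 {E : Type*} [Countable E] [MeasurableSpace E] [MeasurableSingletonClass E]
    (R : E → E → ℝ) (lam μ g : E → ℝ) (ℙ : E → Measure (ℕ → E))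
    (η ξ : E) (fη : E → ℝ) (G : (ℕ → E) → ℝ)
    (hηξ : η ≠ ξ)
    (hRdiag : ∀ η, R η η = 0)
    (hR_nonneg : ∀ η ξ, 0 ≤ R η ξ)
    (hRsum : ∀ η, Summable (R η))
    (hlam : ∀ η, lam η = ∑' ζ, R η ζ)
    (hlampos : ∀ η, 0 < lam η)
    (hμpos : ∀ η, 0 < μ η)
    (hμprob : ∑' ζ, μ ζ = 1)
    (hμsummable : Summable μ)
    (hinv : ∀ ζ, ∑' a, (if a = ζ then 0 else μ a * R a ζ) = μ ζ * lam ζ)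
    (hrev : ∀ a b, μ a * R a b = μ b * R b a)
    (hMfin : Summable fun ζ => lam ζ * μ ζ)
    (hgint : Summable fun ζ => μ ζ * |g ζ|)
    (hprob : ∀ ζ, IsProbabilityMeasure (ℙ ζ))
    (hstart : ∀ ζ, ℙ ζ {ω | ω 0 = ζ} = 1)
    (hMarkov : ∀ (a b : E) (C : Set (ℕ → E)), MeasurableSet C →
      ℙ a {ω | ω 1 = b ∧ (fun n => ω (n + 1)) ∈ C}
        = ENNReal.ofReal (R a b / lam a) * ℙ b C)
    (hrec : ∀ a b, ℙ a {ω | ∃ n, 0 < n ∧ ω n = b} = 1)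
    (hG : ∀ ω, G ω = ∑' n : ℕ,
      (if (n : ℕ∞) < hitT {ξ} ω then g (ω n) / lam (ω n) else 0))
    (hfη : ∀ ζ, fη ζ = (ℙ ζ {ω | hitT {η} ω < hitT {ξ} ω}).toReal) :
    ∫ ω, G ω ∂ℙ η
      = (∑' ζ, μ ζ * g ζ * fη ζ)
        / (lam η * μ η * (ℙ η {ω | retT {ξ} ω < retT {η} ω}).toReal) := by
  have hmarkov : IsMarkovFamily (fun a b => ENNReal.ofReal (R a b / lam a)) ℙ := by
    refine ⟨hprob, fun a => ?_, fun a C hC => ?_⟩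
    · have := hprob a
      exact (prob_compl_eq_zero_iff (measurableSet_eval_eq 0 a)).2 (hstart a)
    · have hU : shiftPath ⁻¹' C = ⋃ c, {ω : ℕ → E | ω 1 = c ∧ (fun n => ω (n + 1)) ∈ C} := by
        ext ω
        simp only [Set.mem_preimage, Set.mem_iUnion, Set.mem_ofPred_eq, exists_and_right,
          exists_eq', true_and]
        rfl
      rw [hU, measure_iUnion]
      · exact tsum_congr fun c => hMarkov a c C hC
      · exact fun c d hcd => Set.disjoint_left.2 fun ω h1 h2 => hcd (h1.1.symm.trans h2.1)
      · exact fun c => (measurableSet_eval_eq 1 c).inter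
          ((measurable_pi_lambda _ fun n => measurable_pi_apply (n + 1)) hC)
  have hbal : ∀ a b, ENNReal.ofReal (lam a * μ a) * ENNReal.ofReal (R a b / lam a) =
      ENNReal.ofReal (lam b * μ b) * ENNReal.ofReal (R b a / lam b) := by
    intro a b
    have hla := (hlampos a).ne'
    have hlb := (hlampos b).ne'
    rw [← ENNReal.ofReal_mul (mul_pos (hlampos a) (hμpos a)).le,
      ← ENNReal.ofReal_mul (mul_pos (hlampos b) (hμpos b)).le]
    congr 1
    field_simp
    linarith [hrev a b]
  have hself := hmarkov.killedGreen_self_mul hηξ (hrec η ξ)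
  set P := ℙ η {ω | retT {ξ} ω < retT {η} ω} with hP_def
  have hP_pos : 0 < P.toReal :=
    ENNReal.toReal_pos (hmarkov.measure_retT_lt_ne_zero hηξ (hrec η ξ))
      (measure_ne_top _ _)
  have hM : 0 < lam η * μ η := mul_pos (hlampos η) (hμpos η)
  have hgreen : ∀ b, killedGreen ℙ ξ η b =
      ENNReal.ofReal (lam b * μ b * fη b / (lam η * μ η * P.toReal)) := by
    intro b
    have hsymm := hmarkov.killedGreen_symm hbal ξ η b
    rw [hmarkov.killedGreen_eq_mul hηξ b] at hsymm
    have hG : killedGreen ℙ ξ η η = ENNReal.ofReal (P.toReal)⁻¹ := by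
      rw [ENNReal.ofReal_inv_of_pos hP_pos, ENNReal.ofReal_toReal (measure_ne_top _ _)]
      exact ENNReal.eq_inv_of_mul_eq_one_left hself
    have hf : hitBefore ℙ η ξ b = ENNReal.ofReal (fη b) := by
      rw [hfη, ENNReal.ofReal_toReal (measure_ne_top _ _)]
      rfl
    have hfnn : 0 ≤ fη b := by
      rw [hfη]
      exact ENNReal.toReal_nonneg
    have hMb : 0 < lam b * μ b := mul_pos (hlampos b) (hμpos b)
    have hM0 : ENNReal.ofReal (lam η * μ η) ≠ 0 := (ENNReal.ofReal_pos.2 hM).ne'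
    refine (ENNReal.mul_right_inj hM0 ENNReal.ofReal_ne_top).1 ?_
    rw [hsymm, hG, hf, ← ENNReal.ofReal_mul hfnn, ← ENNReal.ofReal_mul hMb.le,
      ← ENNReal.ofReal_mul hM.le]
    congr 1
    have hη := (hlampos η).ne'
    have hμ := (hμpos η).ne'
    field_simp
  have hf01 : ∀ b, 0 ≤ fη b ∧ fη b ≤ 1 := fun b => by
    have := hprob b
    rw [hfη]
    exact ⟨ENNReal.toReal_nonneg, ENNReal.toReal_mono ENNReal.one_ne_top prob_le_one⟩
  have hfin : ∑' b, ‖g b / lam b‖ₑ * killedGreen ℙ ξ η b ≠ ∞ := by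
    refine ne_top_of_le_ne_top
      (hgint.div_const (lam η * μ η * P.toReal)).tsum_ofReal_ne_top
      (ENNReal.tsum_le_tsum fun b => ?_)
    rw [hgreen, Real.enorm_eq_ofReal_abs, ← ENNReal.ofReal_mul (abs_nonneg _), abs_div,
      abs_of_pos (hlampos b)]
    refine ENNReal.ofReal_le_ofReal ?_
    have hlb := (hlampos b).ne'
    have : |g b| / lam b * (lam b * μ b * fη b / (lam η * μ η * P.toReal)) =
        μ b * |g b| * fη b / (lam η * μ η * P.toReal) := by
      field_simp
    rw [this]
    refine div_le_div_of_nonneg_right ?_ (mul_pos hM hP_pos).le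
    exact mul_le_of_le_one_right (mul_nonneg (hμpos b).le (abs_nonneg _)) (hf01 b).2
  simp only [hG]
  rw [integral_tsum_killed ℙ ξ η (fun b => g b / lam b) hfin, ← tsum_div_const]
  refine tsum_congr fun b => ?_
  have hlb := hlampos b
  rw [hgreen, ENNReal.toReal_ofReal (div_nonneg (mul_nonneg (mul_pos hlb (hμpos b)).le (hf01 b).1)
    (mul_pos hM hP_pos).le)]
  field_simp
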